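/- Let G = (V,E) be a strongly connected finite simple directed graph and let x, y be distinct vertices of G. Then x ↔² y holds (there exist two vertex-disjoint paths from x to y and two vertex-disjoint paths from y to x in G) if and only if both x ↔^{2s} y and x ↔^{2e} y hold. -/

import Mathlib

variable {V : Type*}

/-- `p` is a simple directed path from `x` to `y` w.r.t. the edge relation `E`. -/
def IsDipath (E : V → V → Prop) (x y : V) (p : List V) : Prop :=
  List.Chain' E p ∧ p.head? = some x ∧ p.getLast? = some y ∧ p.Nodup

/-- The edges of a path, as the list of consecutive pairs. -/
def dipathEdges (p : List V) : List (V × V) := p.zip p.tail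

/-- There are two (distinct, internally vertex-disjoint) paths from `x` to `y`:
they share no vertices other than `x` and `y`. -/
def TwoVDP (E : V → V → Prop) (x y : V) : Prop :=
  ∃ p q : List V, IsDipath E x y p ∧ IsDipath E x y q ∧ p ≠ q ∧
    ∀ z, z ∈ p → z ∈ q → z = x ∨ z = y

/-- There are two edge-disjoint paths from `x` to `y`. -/
def TwoEDP (E : V → V → Prop) (x y : V) : Prop :=
  ∃ p q : List V, IsDipath E x y p ∧ IsDipath E x y q ∧
    ∀ e, e ∈ dipathEdges p → e ∉ dipathEdges q

/-- Reachability in a digraph. -/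
def DiReach (E : V → V → Prop) (x y : V) : Prop := Relation.ReflTransGen E x y

/-- `x` and `y` lie in the same strongly connected component. -/
def InSameSCC (E : V → V → Prop) (x y : V) : Prop := DiReach E x y ∧ DiReach E y x

/-- The digraph is strongly connected. -/
def IsStronglyConn (E : V → V → Prop) : Prop := ∀ x y, DiReach E x y

/-- Deleting a vertex `w` (and its incident edges). -/
def DelVertex (E : V → V → Prop) (w : V) : V → V → Prop :=
  fun a b => E a b ∧ a ≠ w ∧ b ≠ w

/-- `x ↔² y` : two vertex-disjoint paths in both directions. -/
def Rel2d (E : V → V → Prop) (x y : V) : Prop :=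
  x ≠ y ∧ TwoVDP E x y ∧ TwoVDP E y x

/-- `x ↔^{2s} y`. -/
def Rel2s (E : V → V → Prop) (x y : V) : Prop :=
  x ≠ y ∧ ∀ z, z ≠ x → z ≠ y → InSameSCC (DelVertex E z) x y

/-- `x ↔^{2e} y` : two edge-disjoint paths in both directions. -/
def Rel2e (E : V → V → Prop) (x y : V) : Prop :=
  x ≠ y ∧ TwoEDP E x y ∧ TwoEDP E y x

/-- A maximal vertex set of size ≥ `k` all of whose pairs of distinct elements
satisfy the relation `R` (e.g. a 2-directed/2-strong/2-edge block). -/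
def IsMaxBlock (R : V → V → Prop) (k : ℕ) (C : Set V) : Prop :=
  k ≤ C.ncard ∧ (∀ x ∈ C, ∀ y ∈ C, x ≠ y → R x y) ∧
    ∀ D : Set V, C ⊆ D → (∀ x ∈ D, ∀ y ∈ D, x ≠ y → R x y) → D = C

/-- Vertices reachable from the set `A` by a walk inside `S`. -/
inductive Rc {V : Type*} (r : V → V → Prop) (S A : Set V) : V → Prop
  | base (a : V) : a ∈ A → a ∈ S → Rc r S A a
  | step (a b : V) : Rc r S A a → r a b → b ∈ S → Rc r S A b

def Lk {V : Type*} (r : V → V → Prop) (A B S : Set V) : Prop := ∃ b ∈ B, Rc r S A b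

theorem Rc.mem {V : Type*} {r : V → V → Prop} {S A : Set V} {z : V} (h : Rc r S A z) : z ∈ S := by
  cases h <;> assumption

theorem Rc.mono {V : Type*} {r r' : V → V → Prop} {S S' A : Set V} {z : V} (h : Rc r S A z)
    (hr : ∀ a b, r a b → r' a b) (hS : S ⊆ S') : Rc r' S' A z := by
  induction h with
  | base a h1 h2 => exact .base a h1 (hS h2)
  | step a b _ h1 h2 ih => exact .step a b ih (hr _ _ h1) (hS h2)

theorem Rc.comp {V : Type*} {r : V → V → Prop} {S A B : Set V} {z : V}
    (h2 : Rc (fun a b => r b a) S B z) : Rc r S A z → Lk r A B S := by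
  induction h2 with
  | base a h1 h2 => exact fun h => ⟨a, h1, h⟩
  | step a b h0 h1 h2 ih => exact fun h => ih (.step b a h h1 h0.mem)

theorem Lk.rev {V : Type*} {r : V → V → Prop} {S A B : Set V}
    (h : Lk r A B S) : Lk (fun a b => r b a) B A S := by
  obtain ⟨b, hb, h⟩ := h
  exact Rc.comp (r := fun a b => r b a) h (.base b hb h.mem)

theorem Rc.trim {V : Type*} {r : V → V → Prop} {S A : Set V} {t : V} (h : Rc r S A t) :
    ∃ S' : Set V, S' ⊆ S ∧ Rc r S' A t ∧ ∀ z ∈ S', Rc r S A z ∧ (z = t ∨ Rc r (S \ {t}) A z) := by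
  let S' : Set V := {z | z = t ∨ Rc r (S \ {t}) A z}
  have self : ∀ z, Rc r (S \ {t}) A z → Rc r S' A z := by
    intro z hz
    induction hz with
    | base a h1 h2 => exact .base a h1 (Or.inr (.base a h1 h2))
    | step a b h0 h1 h2 ih => exact .step a b ih h1 (Or.inr (.step a b h0 h1 h2))
  have key : ∀ z, Rc r S A z → Rc r S' A t ∨ Rc r (S \ {t}) A z := by
    intro z hz
    induction hz with
    | base a h1 h2 =>
      by_cases hat : a = t
      · subst hat; exact Or.inl (.base a h1 (Or.inl rfl))
      · exact Or.inr (.base a h1 ⟨h2, hat⟩)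
    | step a b h0 h1 h2 ih =>
      rcases ih with ih | ih
      · exact Or.inl ih
      · by_cases hbt : b = t
        · subst hbt; exact Or.inl (.step a b (self a ih) h1 (Or.inl rfl))
        · exact Or.inr (.step a b ih h1 ⟨h2, hbt⟩)
  refine ⟨S', ?_, ?_, ?_⟩
  · rintro z (rfl | hz)
    · exact h.mem
    · exact hz.mem.1
  · rcases key t h with h' | h'
    · exact h'
    · exact absurd rfl h'.mem.2
  · rintro z (rfl | hz)
    · exact ⟨h, Or.inl rfl⟩
    · exact ⟨hz.mono (fun _ _ h => h) Set.sdiff_subset, Or.inr hz⟩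

theorem Lk.cut {V : Type*} {r r' : V → V → Prop} {W A B : Set V} {s u : V}
    (hr : ∀ a b, r' a b → r a b ∨ a = u) (hs : ¬ Lk r A B {s}ᶜ) (h : Lk r' A B W) :
    Lk r A {s, u} W := by
  have key : ∀ z, Rc r' W A z → Lk r A {s, u} W ∨ (Rc r W A z ∧ Rc r {s}ᶜ A z) := by
    intro z hz
    induction hz with
    | base a h1 h2 =>
      by_cases has : a = s
      · exact Or.inl ⟨a, by simp [has], .base a h1 h2⟩
      · exact Or.inr ⟨.base a h1 h2, .base a h1 has⟩
    | step a b h0 h1 h2 ih =>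
      rcases ih with ih | ⟨i1, i2⟩
      · exact Or.inl ih
      rcases hr a b h1 with h1 | h1
      · by_cases hbs : b = s
        · exact Or.inl ⟨b, by simp [hbs], .step a b i1 h1 h2⟩
        · exact Or.inr ⟨.step a b i1 h1 h2, .step a b i2 h1 hbs⟩
      · exact Or.inl ⟨a, by simp [h1], i1⟩
  obtain ⟨b, hb, h⟩ := h
  rcases key b h with h | h
  · exact h
  · exact absurd ⟨b, hb, h.2⟩ hs

theorem split_ends {V : Type*} {r : V → V → Prop} {A : Set V} {s u : V}
    (h : ∃ S T, Disjoint S T ∧ Lk r A {s, u} S ∧ Lk r A {s, u} T) :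
    ∃ S T, Disjoint S T ∧ Rc r S A s ∧ Rc r T A u := by
  obtain ⟨S, T, hd, ⟨a, ha, h1⟩, ⟨b, hb, h2⟩⟩ := h
  have hab : a ≠ b := by
    rintro rfl
    exact Set.disjoint_left.1 hd h1.mem h2.mem
  rcases ha with rfl | rfl <;> rcases hb with rfl | rfl
  · exact absurd rfl hab
  · exact ⟨S, T, hd, h1, h2⟩
  · exact ⟨T, S, hd.symm, h2, h1⟩
  · exact absurd rfl hab

theorem menger_step {V : Type*} {r r' : V → V → Prop} {A B : Set V} {s u v : V}
    (hr : ∀ a b, r' a b ↔ r a b ∨ (a = u ∧ b = v))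
    (ih : ∀ A B : Set V, (∀ z, Lk r A B {z}ᶜ) →
      ∃ S T, Disjoint S T ∧ Lk r A B S ∧ Lk r A B T)
    (h : ∀ z, Lk r' A B {z}ᶜ) (hs : ¬ Lk r A B {s}ᶜ) :
    ∃ S T, Disjoint S T ∧ Lk r' A B S ∧ Lk r' A B T := by
  obtain ⟨S1, T1, d1, a1, b1⟩ := split_ends (ih A {s, u} fun z =>
    (h z).cut (fun a b hab => ((hr a b).1 hab).imp id And.left) hs)
  have h2 := ih {s, v} B fun z => Lk.rev (r := fun a b => r b a)
    ((h z).rev.cut (r := fun a b => r b a) (s := s) (u := v)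
      (fun a b hab => ((hr b a).1 hab).imp id And.right) (fun hh => hs hh.rev))
  obtain ⟨S2, T2, d2, a2, b2⟩ : ∃ S T, Disjoint S T ∧ Rc (fun a b => r b a) S B s ∧
      Rc (fun a b => r b a) T B v := by
    apply split_ends
    obtain ⟨S, T, d, p, q⟩ := h2
    exact ⟨S, T, d, p.rev, q.rev⟩
  obtain ⟨S1', i1, j1, k1⟩ := a1.trim
  obtain ⟨T1', i2, j2, k2⟩ := b1.trim
  obtain ⟨S2', i3, j3, k3⟩ := a2.trim
  obtain ⟨T2', i4, j4, k4⟩ := b2.trim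
  have up : ∀ a b, r a b → r' a b := fun a b h => (hr a b).2 (Or.inl h)
  have up' : ∀ a b, r b a → r' b a := fun a b h => (hr b a).2 (Or.inl h)
  rw [Set.disjoint_left] at d1 d2
  refine ⟨S1' ∪ S2', T1' ∪ T2', ?_, ?_, ?_⟩
  · rw [Set.disjoint_left]
    rintro z (hz | hz) (hz' | hz')
    · exact d1 (i1 hz) (i2 hz')
    · rcases (k1 z hz).2 with rfl | hz1
      · exact d2 a2.mem (i4 hz')
      · apply hs
        refine Rc.comp (z := z) ((k4 z hz').1.mono (fun _ _ h => h) ?_)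
          (hz1.mono (fun _ _ h => h) ?_)
        · rintro w hw rfl
          exact d2 a2.mem hw
        · exact fun w hw => hw.2
    · rcases (k3 z hz).2 with rfl | hz1
      · exact d1 a1.mem (i2 hz')
      · apply hs
        refine Rc.comp (z := z) (hz1.mono (fun _ _ h => h) ?_)
          ((k2 z hz').1.mono (fun _ _ h => h) ?_)
        · exact fun w hw => hw.2
        · rintro w hw rfl
          exact d1 a1.mem hw
    · exact d2 (i3 hz) (i4 hz')
  · exact Rc.comp (z := s) (j3.mono up' Set.subset_union_right) (j1.mono up Set.subset_union_left)
  · refine Rc.comp (z := v) (j4.mono up' Set.subset_union_right) ?_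
    exact .step u v (j2.mono up Set.subset_union_left) ((hr _ _).2 (Or.inr ⟨rfl, rfl⟩))
      (Or.inr j4.mem)

theorem menger2 {V : Type*} [Nonempty V] (F : Set (V × V)) (hF : F.Finite) :
    ∀ A B : Set V, (∀ z, Lk (fun a b => (a, b) ∈ F) A B {z}ᶜ) →
      ∃ S T, Disjoint S T ∧ Lk (fun a b => (a, b) ∈ F) A B S ∧
        Lk (fun a b => (a, b) ∈ F) A B T := by
  induction F, hF using Set.Finite.induction_on with
  | empty =>
    intro A B h
    have h' : ∀ z, ∃ a, a ∈ A ∧ a ∈ B ∧ a ≠ z := by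
      intro z
      obtain ⟨b, hb, h⟩ := h z
      cases h with
      | base _ h1 h2 => exact ⟨b, h1, hb, h2⟩
      | step a _ _ h1 _ => exact absurd h1 (Set.notMem_empty _)
    obtain ⟨a, ha, ha', -⟩ := h' (Classical.arbitrary V)
    obtain ⟨b, hb, hb', hab⟩ := h' a
    exact ⟨{a}, {b}, by simpa using hab.symm, ⟨a, ha', .base a ha rfl⟩, ⟨b, hb', .base b hb rfl⟩⟩
  | @insert e F _ _ ih =>
    intro A B h
    by_cases hs : ∀ z, Lk (fun a b => (a, b) ∈ F) A B {z}ᶜ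
    · obtain ⟨S, T, d, ⟨b, hb, p⟩, ⟨c, hc, q⟩⟩ := ih A B hs
      exact ⟨S, T, d, ⟨b, hb, p.mono (fun _ _ h => Or.inr h) subset_rfl⟩,
        ⟨c, hc, q.mono (fun _ _ h => Or.inr h) subset_rfl⟩⟩
    · push Not at hs
      obtain ⟨s, hs⟩ := hs
      refine menger_step (r := fun a b => (a, b) ∈ F) (u := e.1) (v := e.2) ?_ ih h hs
      intro a b
      rw [Set.mem_insert_iff, Prod.ext_iff, or_comm]

/-! Lists -/

theorem exists_dipath {V : Type*} {r : V → V → Prop} {x y : V}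
    (h : Relation.ReflTransGen r x y) : ∃ p, IsDipath r x y p := by
  induction h using Relation.ReflTransGen.head_induction_on with
  | refl => exact ⟨[y], List.isChain_singleton y, rfl, rfl, List.nodup_singleton y⟩
  | @head a c hac _ ih =>
    obtain ⟨p, h1, h2, h3, h4⟩ := ih
    by_cases hap : a ∈ p
    · obtain ⟨l1, l2, rfl⟩ := List.append_of_mem hap
      refine ⟨a :: l2, ?_, rfl, ?_, ?_⟩
      · exact (List.isChain_append.1 h1).2.1
      · simpa using h3
      · exact (List.nodup_append.1 h4).2.1
    · refine ⟨a :: p, ?_, rfl, ?_, ?_⟩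
      · refine List.isChain_cons.2 ⟨?_, h1⟩
        intro b hb
        rw [h2] at hb
        cases hb
        exact hac
      · cases p with
        | nil => simp at h2
        | cons b l => simpa using h3
      · exact List.nodup_cons.2 ⟨hap, h4⟩

theorem chain_reach {V : Type*} {r r' : V → V → Prop} (p : List V) : ∀ x y, List.Chain' r p →
    p.head? = some x → p.getLast? = some y →
    (∀ a b, a ∈ p → b ∈ p → r a b → r' a b) → Relation.ReflTransGen r' x y := by
  induction p with
  | nil => intro x y _ h; simp at h
  | cons a l ih =>
    intro x y h1 h2 h3 h4
    simp only [List.head?_cons, Option.some.injEq] at h2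
    subst h2
    cases l with
    | nil => simp at h3; subst h3; exact .refl
    | cons b l =>
      have h1' := List.isChain_cons_cons.1 h1
      refine .head (h4 a b (by simp) (by simp) h1'.1) (ih b y h1'.2 rfl (by simpa using h3) ?_)
      intro c d hc hd
      exact h4 c d (List.mem_cons_of_mem _ hc) (List.mem_cons_of_mem _ hd)

theorem chain_inv {V : Type*} {r : V → V → Prop} {P : V → Prop} (hr : ∀ a b, r a b → P b)
    (p : List V) : ∀ x, List.Chain' r p → p.head? = some x → P x → ∀ z ∈ p, P z := by
  induction p with
  | nil => simp
  | cons a l ih =>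
    intro x h1 h2 h3 z hz
    simp only [List.head?_cons, Option.some.injEq] at h2
    subst h2
    rcases List.mem_cons.1 hz with rfl | hz
    · exact h3
    cases l with
    | nil => simp at hz
    | cons b l =>
      have h1' := List.isChain_cons_cons.1 h1
      exact ih b h1'.2 rfl (hr _ _ h1'.1) z hz

theorem edge_last {V : Type*} (p : List V) : ∀ {y b : V}, p.Nodup → p.getLast? = some y →
    (y, b) ∉ dipathEdges p := by
  induction p with
  | nil => intro y b _ h; simp at h
  | cons a l ih =>
    intro y b h1 h2 h3
    cases l with
    | nil => simp [dipathEdges] at h3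
    | cons c l =>
      have h2' : (c :: l).getLast? = some y := by simpa using h2
      have hy : y ∈ c :: l := List.mem_of_getLast? h2'
      have h1' := List.nodup_cons.1 h1
      have h3' : (y, b) = (a, c) ∨ (y, b) ∈ dipathEdges (c :: l) := by
        simpa [dipathEdges] using h3
      rcases h3' with h3 | h3
      · have : y = a := (Prod.ext_iff.1 h3).1
        exact h1'.1 (this ▸ hy)
      · exact ih h1'.2 h2' h3

theorem edge_xy {V : Type*} {E : V → V → Prop} {x y : V} {p : List V} (h : IsDipath E x y p)
    (he : (x, y) ∈ dipathEdges p) : p = [x, y] := by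
  obtain ⟨-, h2, h3, h4⟩ := h
  match p, h2, h3, h4, he with
  | [a], _, _, _, he => simp [dipathEdges] at he
  | a :: c :: l, h2, h3, h4, he =>
    simp only [List.head?_cons, Option.some.injEq] at h2
    subst h2
    have h4' := List.nodup_cons.1 h4
    have he' : (a, y) = (a, c) ∨ (a, y) ∈ dipathEdges (c :: l) := by
      simpa [dipathEdges] using he
    rcases he' with he | he
    · have hyc : y = c := (Prod.ext_iff.1 he).2
      subst hyc
      cases l with
      | nil => rfl
      | cons d l =>
        have : y ∈ d :: l := List.mem_of_getLast? (by simpa using h3)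
        exact absurd this (List.nodup_cons.1 h4'.2).1
    · exact absurd (List.of_mem_zip he).1 h4'.1

theorem vdp_edp {V : Type*} {E : V → V → Prop} {x y : V} (h : TwoVDP E x y) : TwoEDP E x y := by
  obtain ⟨p, q, hp, hq, hne, hd⟩ := h
  refine ⟨p, q, hp, hq, ?_⟩
  rintro ⟨a, b⟩ h1 h2
  have m1 := List.of_mem_zip h1
  have m2 := List.of_mem_zip h2
  have ha : a = x := by
    rcases hd a m1.1 m2.1 with h | h
    · exact h
    · subst h; exact absurd h1 (edge_last p hp.2.2.2 hp.2.2.1)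
  have hb : b = y := by
    rcases hd b (List.mem_of_mem_tail m1.2) (List.mem_of_mem_tail m2.2) with h | h
    · subst h
      obtain ⟨-, h2, -, h4⟩ := hp
      cases p with
      | nil => simp at h2
      | cons c l =>
        simp only [List.head?_cons, Option.some.injEq] at h2
        subst h2
        exact absurd m1.2 (List.nodup_cons.1 h4).1
    · exact h
  subst ha hb
  exact hne ((edge_xy hp h1).trans (edge_xy hq h2).symm)

theorem vdp_del {V : Type*} {E : V → V → Prop} {x y : V} (h : TwoVDP E x y) (z : V)
    (hx : z ≠ x) (hy : z ≠ y) : DiReach (DelVertex E z) x y := by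
  obtain ⟨p, q, hp, hq, hne, hd⟩ := h
  have aux : ∀ p, IsDipath E x y p → z ∉ p → DiReach (DelVertex E z) x y := by
    intro p hp hz
    refine chain_reach p x y hp.1 hp.2.1 hp.2.2.1 fun a b ha hb hab => ⟨hab, ?_, ?_⟩
    · rintro rfl; exact hz ha
    · rintro rfl; exact hz hb
  by_cases hzp : z ∈ p
  · refine aux q hq fun hzq => ?_
    rcases hd z hzp hzq with h | h
    · exact hx h
    · exact hy h
  · exact aux p hp hzp

/-- A walk in `r` from `x` to `y` yields a walk between the neighbourhoods avoiding `x` and `y`. -/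
theorem reach_lk {V : Type*} {r E : V → V → Prop} {x y : V} {W : Set V}
    (hrE : ∀ a b, r a b → E a b) (hxy : x ≠ y) (hE : ¬ E x y)
    (hW : ∀ a b, r a b → b ≠ x → b ≠ y → b ∈ W)
    (h : Relation.ReflTransGen r x y) :
    Lk (fun a b => (a, b) ∈ {e : V × V | E e.1 e.2}) {a | E x a} {b | E b y} W := by
  have key : ∀ z, Relation.ReflTransGen r x z →
      Lk (fun a b => (a, b) ∈ {e : V × V | E e.1 e.2}) {a | E x a} {b | E b y} W ∨ z = x ∨
      (z ≠ y ∧ Rc (fun a b => (a, b) ∈ {e : V × V | E e.1 e.2}) W {a | E x a} z) := by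
    intro z hz
    induction hz with
    | refl => exact Or.inr (Or.inl rfl)
    | @tail b c _ hbc ih =>
      by_cases hcx : c = x
      · exact Or.inr (Or.inl hcx)
      rcases ih with ih | rfl | ⟨i1, i2⟩
      · exact Or.inl ih
      · have hcy : c ≠ y := by rintro rfl; exact hE (hrE _ _ hbc)
        exact Or.inr (Or.inr ⟨hcy, .base c (hrE _ _ hbc) (hW _ _ hbc hcx hcy)⟩)
      · by_cases hcy : c = y
        · subst hcy; exact Or.inl ⟨b, hrE _ _ hbc, i2⟩
        · exact Or.inr (Or.inr ⟨hcy, .step b c i2 (hrE _ _ hbc) (hW _ _ hbc hcx hcy)⟩)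
  rcases key y h with h | h | h
  · exact h
  · exact absurd h.symm hxy
  · exact absurd rfl h.1

theorem lk_path {V : Type*} {E : V → V → Prop} {x y : V} {S : Set V}
    (h : Lk (fun a b => (a, b) ∈ {e : V × V | E e.1 e.2}) {a | E x a} {b | E b y} S) :
    ∃ p, IsDipath E x y p ∧ ∀ z ∈ p, z = x ∨ z = y ∨ z ∈ S := by
  let r : V → V → Prop := fun a b => E a b ∧ (b = x ∨ b = y ∨ b ∈ S)
  have key : ∀ z, Rc (fun a b => (a, b) ∈ {e : V × V | E e.1 e.2}) S {a | E x a} z →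
      Relation.ReflTransGen r x z := by
    intro z hz
    induction hz with
    | base a h1 h2 => exact .single ⟨h1, Or.inr (Or.inr h2)⟩
    | step a b _ h1 h2 ih => exact ih.tail ⟨h1, Or.inr (Or.inr h2)⟩
  obtain ⟨b, hb, h⟩ := h
  obtain ⟨p, h1, h2, h3, h4⟩ := exists_dipath ((key b h).tail (⟨hb, Or.inr (Or.inl rfl)⟩ : r b y))
  exact ⟨p, ⟨h1.imp fun _ _ h => h.1, h2, h3, h4⟩,
    chain_inv (fun _ _ h => h.2) p x h1 h2 (Or.inl rfl)⟩

theorem path_internal {V : Type*} {E : V → V → Prop} {x y : V} (hxy : x ≠ y) (hE : ¬ E x y)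
    {p : List V} (h : IsDipath E x y p) : ∃ z ∈ p, z ≠ x ∧ z ≠ y := by
  obtain ⟨h1, h2, h3, h4⟩ := h
  match p, h1, h2, h3, h4 with
  | [a], _, h2, h3, _ =>
    simp at h2 h3
    exact absurd (h2.symm.trans h3) hxy
  | a :: c :: l, h1, h2, h3, h4 =>
    simp only [List.head?_cons, Option.some.injEq] at h2
    subst h2
    refine ⟨c, by simp, ?_, ?_⟩
    · rintro rfl; simp at h4
    · rintro rfl; exact hE (List.isChain_cons_cons.1 h1).1

theorem main_dir {V : Type*} [Fintype V] {E : V → V → Prop} {x y : V} (hxy : x ≠ y)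
    (hsc : IsStronglyConn E)
    (hs : ∀ z, z ≠ x → z ≠ y → DiReach (DelVertex E z) x y) (he : TwoEDP E x y) :
    TwoVDP E x y := by
  by_cases hE : E x y
  · have hpath : IsDipath E x y [x, y] := by
      refine ⟨List.isChain_pair.2 hE, rfl, rfl, by simpa using hxy⟩
    have aux : ∀ q, IsDipath E x y q → q ≠ [x, y] → TwoVDP E x y := fun q hq hne =>
      ⟨[x, y], q, hpath, hq, hne.symm, fun z hz _ => by simpa using hz⟩
    obtain ⟨p, q, hp, hq, hd⟩ := he
    by_cases h : p = [x, y]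
    · refine aux q hq ?_
      rintro rfl
      subst h
      exact hd (x, y) (by simp [dipathEdges]) (by simp [dipathEdges])
    · exact aux p hp h
  · haveI : Nonempty V := ⟨x⟩
    have hlk : ∀ z, Lk (fun a b => (a, b) ∈ {e : V × V | E e.1 e.2}) {a | E x a} {b | E b y}
        {z}ᶜ := by
      intro z
      by_cases hz : z = x ∨ z = y
      · refine reach_lk (r := E) (fun _ _ h => h) hxy hE ?_ (hsc x y)
        rintro a b - hbx hby rfl
        exact hz.elim hbx hby
      · push Not at hz
        exact reach_lk (r := DelVertex E z) (fun _ _ h => h.1) hxy hE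
          (fun a b h _ _ => h.2.2) (hs z hz.1 hz.2)
    obtain ⟨S, T, hd, h1, h2⟩ := menger2 _ (Set.toFinite _) _ _ hlk
    obtain ⟨p, hp, hpS⟩ := lk_path h1
    obtain ⟨q, hq, hqT⟩ := lk_path h2
    have hdis : ∀ z, z ∈ p → z ∈ q → z = x ∨ z = y := by
      intro z hz hz'
      have a := hpS z hz
      have b := hqT z hz'
      have c : z ∈ S → z ∉ T := fun h => Set.disjoint_left.1 hd h
      tauto
    refine ⟨p, q, hp, hq, ?_, hdis⟩
    rintro rfl
    obtain ⟨z, hz, hzx, hzy⟩ := path_internal hxy hE hp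
    exact (hdis z hz hz).elim hzx hzy

/-- Lemma 19: for distinct vertices of a strongly connected finite
simple digraph, `x ↔² y` iff both `x ↔^{2s} y` and `x ↔^{2e} y`. -/
theorem stmt13 {V : Type*} [Fintype V] (E : V → V → Prop)
    (hirr : ∀ v, ¬ E v v) (hsc : IsStronglyConn E) (x y : V) (hxy : x ≠ y) :
    Rel2d E x y ↔ (Rel2s E x y ∧ Rel2e E x y) := by
  constructor
  · rintro ⟨-, h1, h2⟩
    exact ⟨⟨hxy, fun z hx hy => ⟨vdp_del h1 z hx hy, vdp_del h2 z hy hx⟩⟩,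
      ⟨hxy, vdp_edp h1, vdp_edp h2⟩⟩
  · rintro ⟨⟨-, hs⟩, ⟨-, h1, h2⟩⟩
    exact ⟨hxy, main_dir hxy hsc (fun z hx hy => (hs z hx hy).1) h1,
      main_dir hxy.symm hsc (fun z hy hx => (hs z hx hy).2) h2⟩
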